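/- A recurrent infinite word is ultimately periodic if and only if it has a factor possessing exactly one return word. -/

import Mathlib

variable {α : Type*}

/-- The factor of the infinite word `w` of length `n` starting at position `i`. -/
def factorAt (w : ℕ → α) (i n : ℕ) : List α :=
  (List.range n).map fun k => w (i + k)

/-- `u` is a factor of the infinite word `w`. -/
def IsFactor (w : ℕ → α) (u : List α) : Prop :=
  ∃ i, factorAt w i u.length = u

/-- `w` is recurrent: each of its factors occurs infinitely many times. -/
def Recurrent (w : ℕ → α) : Prop :=
  ∀ u : List α, IsFactor w u → ∀ N : ℕ, ∃ i, N ≤ i ∧ factorAt w i u.length = u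

/-- `w` is periodic: there is `T > 0` with `w (n + T) = w n` for all `n`. -/
def Periodic (w : ℕ → α) : Prop :=
  ∃ T : ℕ, 0 < T ∧ ∀ n, w (n + T) = w n

def Aperiodic (w : ℕ → α) : Prop := ¬ Periodic w

def UltimatelyPeriodic (w : ℕ → α) : Prop :=
  ∃ N T : ℕ, 0 < T ∧ ∀ n, N ≤ n → w (n + T) = w n

/-- `w` is Sturmian: aperiodic with subword complexity `n + 1`. -/
def Sturmian (w : ℕ → α) : Prop :=
  Aperiodic w ∧ ∀ n : ℕ, {u : List α | u.length = n ∧ IsFactor w u}.ncard = n + 1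

/-- Positions where `u` occurs in `w`. -/
def Occurrences (w : ℕ → α) (u : List α) : Set ℕ :=
  {i | factorAt w i u.length = u}

/-- The return words of `u` in `w`: words from one occurrence of `u` to the next. -/
def ReturnWords (w : ℕ → α) (u : List α) : Set (List α) :=
  {r | ∃ i j : ℕ, i ∈ Occurrences w u ∧ j ∈ Occurrences w u ∧ i < j ∧
    (∀ k, i < k → k < j → k ∉ Occurrences w u) ∧ r = factorAt w i (j - i)}

/-- Positions where a word abelian-equivalent to `u` occurs in `w`. -/
def AbelianOccurrences (w : ℕ → α) (u : List α) : Set ℕ :=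
  {i | List.Perm (factorAt w i u.length) u}

/-- The abelian return words of `u` in `w`. -/
def AbelianReturnWords (w : ℕ → α) (u : List α) : Set (List α) :=
  {r | ∃ i j : ℕ, i ∈ AbelianOccurrences w u ∧ j ∈ AbelianOccurrences w u ∧ i < j ∧
    (∀ k, i < k → k < j → k ∉ AbelianOccurrences w u) ∧ r = factorAt w i (j - i)}

/-- The abelian equivalence classes (as multisets) of the abelian return words of `u` in `w`. -/
def abelianReturnClasses (w : ℕ → α) (u : List α) : Set (Multiset α) :=
  (fun r : List α => (r : Multiset α)) '' AbelianReturnWords w u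

def RightSpecial (w : ℕ → α) (u : List α) : Prop :=
  ∃ a b : α, a ≠ b ∧ IsFactor w (u ++ [a]) ∧ IsFactor w (u ++ [b])

def LeftSpecial (w : ℕ → α) (u : List α) : Prop :=
  ∃ a b : α, a ≠ b ∧ IsFactor w (a :: u) ∧ IsFactor w (b :: u)

def Bispecial (w : ℕ → α) (u : List α) : Prop :=
  RightSpecial w u ∧ LeftSpecial w u

/-- A factor is singular if it is the only factor of `w` in its abelian class. -/
def Singular (w : ℕ → α) (u : List α) : Prop :=
  ∀ v : List α, IsFactor w v → List.Perm v u → v = u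

/-- `w` is an infinite concatenation of words from `S`. -/
def InfConcat (S : Set (List α)) (w : ℕ → α) : Prop :=
  ∃ f : ℕ → List α, (∀ n, f n ∈ S) ∧
    ∀ n, factorAt w (((List.range n).map fun k => (f k).length).sum) (f n).length = f n

/-- A finite binary word is balanced if any two factors of equal length have numbers
of occurrences of `true` differing by at most one. -/
def BalancedList (w : List Bool) : Prop :=
  ∀ u v : List Bool, u <:+: w → v <:+: w → u.length = v.length →
    |(u.count true : ℤ) - (v.count true : ℤ)| ≤ 1


theorem factorAt_eq_factorAt_iff (w : ℕ → α) (i j n : ℕ) :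
    factorAt w i n = factorAt w j n ↔ ∀ k < n, w (i + k) = w (j + k) := by
  simp [factorAt]

theorem length_factorAt (w : ℕ → α) (i n : ℕ) : (factorAt w i n).length = n := by
  simp [factorAt]

theorem Recurrent.periodic {w : ℕ → α} (hrec : Recurrent w) (h : UltimatelyPeriodic w) :
    Periodic w := by
  obtain ⟨N, T, hT, hw⟩ := h
  refine ⟨T, hT, fun n => ?_⟩
  obtain ⟨i, hi, he⟩ := hrec (factorAt w n (T + 1)) ⟨n, by rw [length_factorAt]⟩ N
  rw [length_factorAt, factorAt_eq_factorAt_iff] at he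
  rw [← he T (by omega), hw i hi]
  exact he 0 (by omega)

/-- In a periodic word, the prefix whose length is the least period is its own only return word. -/
theorem Periodic.exists_returnWords_eq_singleton {w : ℕ → α} (h : Periodic w) :
    ∃ n, ReturnWords w (factorAt w 0 n) = {factorAt w 0 n} := by
  classical
  obtain ⟨T, ⟨hT, hw⟩, hmin⟩ : ∃ T, (0 < T ∧ ∀ n, w (n + T) = w n) ∧
      ∀ S, 0 < S → (∀ n, w (n + S) = w n) → T ≤ S :=
    ⟨Nat.find h, Nat.find_spec h, fun S hS hwS => Nat.find_min' h ⟨hS, hwS⟩⟩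
  have mem_occ : ∀ i, i ∈ Occurrences w (factorAt w 0 T) ↔ ∀ n, w (n + i) = w n := by
    intro i
    rw [Occurrences, Set.mem_ofPred_eq, length_factorAt, factorAt_eq_factorAt_iff]
    constructor
    · intro hi n
      induction n using Nat.strong_induction_on with
      | _ n ih =>
        by_cases hn : n < T
        · simpa [add_comm] using hi n hn
        · obtain ⟨m, rfl⟩ := Nat.exists_eq_add_of_le' (not_lt.mp hn)
          rw [hw, add_right_comm, hw, ih m (by omega)]
    · intro hi k _
      rw [add_comm i, hi, zero_add]
  have period_of_occ : ∀ i j, i ∈ Occurrences w (factorAt w 0 T) →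
      j ∈ Occurrences w (factorAt w 0 T) → i < j → T ≤ j - i := by
    intro i j hi hj hij
    rw [mem_occ] at hi hj
    refine hmin _ (by omega) fun n => ?_
    rw [← hi, add_assoc, Nat.sub_add_cancel hij.le, hj]
  refine ⟨T, Set.ext fun r => ?_⟩
  rw [Set.mem_singleton_iff]
  constructor
  · rintro ⟨i, j, hi, hj, hij, hnone, rfl⟩
    have hle := period_of_occ i j hi hj hij
    have hocc : i + T ∈ Occurrences w (factorAt w 0 T) := by
      rw [mem_occ] at hi ⊢
      intro n
      rw [← add_assoc, hw, hi]
    have hge : ¬ i + T < j := fun hlt => hnone _ (by omega) hlt hocc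
    rw [show j - i = T by omega]
    simpa [Occurrences, length_factorAt] using hi
  · rintro rfl
    have h0 : 0 ∈ Occurrences w (factorAt w 0 T) := (mem_occ 0).2 fun _ => rfl
    refine ⟨0, T, h0, (mem_occ T).2 hw, hT, fun k hk hkT hocc => ?_, rfl⟩
    have := period_of_occ 0 k h0 hocc hk
    omega

theorem Recurrent.exists_next_occurrence {w : ℕ → α} (hrec : Recurrent w) {u : List α} {i : ℕ}
    (hi : i ∈ Occurrences w u) :
    ∃ j ∈ Occurrences w u, i < j ∧ ∀ k, i < k → k < j → k ∉ Occurrences w u := by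
  classical
  have hex : ∃ j, i < j ∧ j ∈ Occurrences w u := by
    obtain ⟨j, hj, hocc⟩ := hrec u ⟨i, hi⟩ (i + 1)
    exact ⟨j, hj, hocc⟩
  obtain ⟨hlt, hocc⟩ := Nat.find_spec hex
  exact ⟨_, hocc, hlt, fun k hk hkj hkocc => Nat.find_min hex hkj ⟨hk, hkocc⟩⟩

theorem Recurrent.ultimatelyPeriodic_of_returnWords_eq_singleton {w : ℕ → α} (hrec : Recurrent w)
    {u r : List α} (hu : IsFactor w u) (hr : ReturnWords w u = {r}) : UltimatelyPeriodic w := by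
  have step : ∀ i ∈ Occurrences w u,
      0 < r.length ∧ i + r.length ∈ Occurrences w u ∧ factorAt w i r.length = r := by
    intro i hi
    obtain ⟨j, hj, hij, hnone⟩ := hrec.exists_next_occurrence hi
    have he : factorAt w i (j - i) = r := by
      have hmem : factorAt w i (j - i) ∈ ReturnWords w u := ⟨i, j, hi, hj, hij, hnone, rfl⟩
      rwa [hr] at hmem
    have hlen : r.length = j - i := by rw [← he, length_factorAt]
    rw [hlen, Nat.add_sub_cancel' hij.le]
    exact ⟨by omega, hj, he⟩
  obtain ⟨i, hi⟩ := hu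
  have hpos := (step i hi).1
  have hocc : ∀ q, i + r.length * q ∈ Occurrences w u := by
    intro q
    induction q with
    | zero => exact hi
    | succ q ih =>
      rw [Nat.mul_succ, ← add_assoc]
      exact (step _ ih).2.1
  refine ⟨i, r.length, hpos, fun n hn => ?_⟩
  obtain ⟨m, rfl⟩ := Nat.exists_eq_add_of_le hn
  have h₁ := step _ (hocc (m / r.length))
  have heq := (step _ h₁.2.1).2.2.trans h₁.2.2.symm
  rw [factorAt_eq_factorAt_iff] at heq
  have key := heq (m % r.length) (Nat.mod_lt _ hpos)
  rwa [add_right_comm, add_assoc i, Nat.div_add_mod] at key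

/-- Vuillon. A recurrent infinite word is ultimately periodic if and only
if it has a factor possessing exactly one return word. -/
theorem ultimately_periodic_iff_exists_factor_one_return {α : Type*} [Fintype α]
    (w : ℕ → α) (hrec : Recurrent w) :
    UltimatelyPeriodic w ↔ ∃ u : List α, IsFactor w u ∧ (ReturnWords w u).encard = 1 := by
  constructor
  · intro h
    obtain ⟨n, hn⟩ := (hrec.periodic h).exists_returnWords_eq_singleton
    exact ⟨factorAt w 0 n, ⟨0, by rw [length_factorAt]⟩, by rw [hn, Set.encard_singleton]⟩
  · rintro ⟨u, hu, hcard⟩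
    obtain ⟨r, hr⟩ := Set.encard_eq_one.mp hcard
    exact hrec.ultimatelyPeriodic_of_returnWords_eq_singleton hu hr
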